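/- The minimum algebraic connectivity (second-smallest Laplacian eigenvalue) over all connected simple graphs on n ≥ 2 vertices equals 2(1 - cos(π/n)), and is attained by the path (line) graph on n vertices. -/

import Mathlib

open Real

/-- The algebraic connectivity of a simple graph `G` on `n` vertices: the second-smallest
eigenvalue (with multiplicity) of its Laplacian matrix `L = D - A`. -/
noncomputable def algebraicConnectivity (n : ℕ) (G : SimpleGraph (Fin n)) : ℝ :=
  letI : DecidableRel G.Adj := Classical.decRel _
  (((List.ofFn (SimpleGraph.posSemidef_lapMatrix (R := ℝ) G).1.eigenvalues).mergeSort
      (fun a b => decide (a ≤ b))).getD 1 0)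

open scoped Matrix

/-- Discrete Dirichlet inequality. -/
lemma dirichlet_ineq (n : ℕ) (hn : 2 ≤ n) (S : ℕ → ℝ) (h0 : S 0 = 0) (h1 : S n = 0) :
    2 * (1 - Real.cos (Real.pi / n)) * ∑ k ∈ Finset.range n, S k ^ 2
      ≤ ∑ k ∈ Finset.range n, (S (k + 1) - S k) ^ 2 := by
  have hn0 : (0 : ℝ) < n := by positivity
  set θ : ℝ := Real.pi / n with hθ
  have hnθ : n * θ = Real.pi := by rw [hθ]; field_simp
  have hθ0 : 0 < θ := by positivity
  have hpos : ∀ k : ℕ, 1 ≤ k → k < n → 0 < Real.sin (k * θ) := by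
    intro k hk hkn
    have hk' : (0 : ℝ) < k := by exact_mod_cast hk
    apply Real.sin_pos_of_pos_of_lt_pi (by positivity)
    rw [← hnθ]
    have : (k : ℝ) < n := by exact_mod_cast hkn
    nlinarith
  have hrec : ∀ k : ℕ, Real.sin ((k + 2 : ℕ) * θ) + Real.sin (k * θ)
      = 2 * Real.cos θ * Real.sin ((k + 1 : ℕ) * θ) := by
    intro k
    have e1 : ((k + 2 : ℕ) : ℝ) * θ = (k + 1 : ℕ) * θ + θ := by push_cast; ring
    have e2 : ((k : ℕ) : ℝ) * θ = (k + 1 : ℕ) * θ - θ := by push_cast; ring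
    rw [e1, e2, Real.sin_add, Real.sin_sub]; ring
  set lam := 2 * (1 - Real.cos θ) with hlam
  have key : ∀ m : ℕ, m + 1 < n →
      S (m + 1) ^ 2 * (1 - Real.sin (m * θ) / Real.sin ((m + 1 : ℕ) * θ)) ≤
      ∑ k ∈ Finset.range (m + 1), (S (k + 1) - S k) ^ 2
        - lam * ∑ k ∈ Finset.range (m + 1), S k ^ 2 := by
    intro m
    induction m with
    | zero => intro _; simp [h0]
    | succ m ih =>
      intro hm
      have ih := ih (by omega)
      rw [Finset.sum_range_succ, Finset.sum_range_succ _ (m + 1)]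
      have p1 := hpos (m + 1) (by omega) (by omega)
      have p2 := hpos (m + 2) (by omega) (by omega)
      have hr := hrec m
      rw [show m + 1 + 1 = m + 2 from rfl]
      set a := Real.sin (m * θ)
      set b := Real.sin ((m + 1 : ℕ) * θ)
      set c := Real.sin ((m + 2 : ℕ) * θ)
      set X := S (m + 1)
      set Y := S (m + 2)
      have e : a / b = 2 * Real.cos θ - c / b := by field_simp; linarith
      have sq : 0 ≤ X ^ 2 * (c / b) + Y ^ 2 * (b / c) - 2 * X * Y := by
        have : X ^ 2 * (c / b) + Y ^ 2 * (b / c) - 2 * X * Y = (X * c - Y * b) ^ 2 / (b * c) := by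
          field_simp; ring
        rw [this]; positivity
      rw [e] at ih
      nlinarith
  obtain ⟨m, rfl⟩ : ∃ m, n = m + 2 := ⟨n - 2, by omega⟩
  have hk := key m (by omega)
  rw [Finset.sum_range_succ, Finset.sum_range_succ _ (m + 1)]
  have p1 := hpos (m + 1) (by omega) (by omega)
  have hr := hrec m
  rw [hnθ, Real.sin_pi] at hr
  rw [show m + 1 + 1 = m + 2 from rfl, h1]
  have e : Real.sin (m * θ) / Real.sin ((m + 1 : ℕ) * θ) = 2 * Real.cos θ := by
    rw [div_eq_iff p1.ne']; linarith
  rw [e] at hk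
  nlinarith

/-- Discrete Wirtinger inequality. -/
lemma wirtinger_ineq (m : ℕ) (hm : 1 ≤ m) (y : ℕ → ℝ)
    (hy : ∑ k ∈ Finset.range (m + 1), y k = 0) :
    2 * (1 - Real.cos (Real.pi / (m + 1 : ℕ))) * ∑ k ∈ Finset.range (m + 1), y k ^ 2
      ≤ ∑ k ∈ Finset.range m, (y (k + 1) - y k) ^ 2 := by
  set S : ℕ → ℝ := fun k => ∑ i ∈ Finset.range k, y i with hS
  have hSs : ∀ k, S (k + 1) - S k = y k := by
    intro k; simp [hS, Finset.sum_range_succ]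
  have hD := dirichlet_ineq (m + 1) (by omega) S (by simp [hS]) hy
  simp only [hSs] at hD
  set lam := 2 * (1 - Real.cos (Real.pi / (m + 1 : ℕ))) with hlam
  have hl0 : 0 ≤ lam := by
    have := Real.cos_le_one (Real.pi / (m + 1 : ℕ)); rw [hlam]; linarith
  rw [Finset.sum_range_succ'] at hD
  have hid : ∀ m : ℕ, ∑ k ∈ Finset.range (m + 1), y k ^ 2 =
      S (m + 1) * y m - ∑ k ∈ Finset.range m, S (k + 1) * (y (k + 1) - y k) := by
    intro m
    induction m with
    | zero => simp [hS]; ring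
    | succ m ih =>
      rw [Finset.sum_range_succ, ih, Finset.sum_range_succ _ m]
      have := hSs (m + 1)
      linear_combination (- y (m + 1)) * this
  have hidm := hid m
  have hSm : S (m + 1) = 0 := hy
  rw [hSm] at hidm
  have hsq : 0 ≤ ∑ k ∈ Finset.range m, ((y (k + 1) - y k) + lam * S (k + 1)) ^ 2 :=
    Finset.sum_nonneg fun _ _ => sq_nonneg _
  have hex : ∑ k ∈ Finset.range m, ((y (k + 1) - y k) + lam * S (k + 1)) ^ 2 =
      ∑ k ∈ Finset.range m, (y (k + 1) - y k) ^ 2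
      + 2 * lam * ∑ k ∈ Finset.range m, S (k + 1) * (y (k + 1) - y k)
      + lam ^ 2 * ∑ k ∈ Finset.range m, S (k + 1) ^ 2 := by
    rw [Finset.mul_sum, Finset.mul_sum, ← Finset.sum_add_distrib, ← Finset.sum_add_distrib]
    exact Finset.sum_congr rfl fun _ _ => by ring
  rw [hex] at hsq
  have hS0 : S 0 = 0 := by simp [hS]
  rw [hS0] at hD
  have := mul_le_mul_of_nonneg_left hD hl0
  nlinarith

/-- Every initial cut is crossed by an edge. -/
lemma exists_cut_edge (m : ℕ) (H : SimpleGraph (Fin (m + 1))) (hH : H.Connected) (k : ℕ)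
    (hk : k < m) : ∃ i j : Fin (m + 1), H.Adj i j ∧ i.val ≤ k ∧ k < j.val := by
  obtain ⟨p⟩ := hH.preconnected (0 : Fin (m + 1)) (Fin.last m)
  obtain ⟨d, -, h1, h2⟩ := p.exists_boundary_dart {i | i.val ≤ k} (by simp) (by simpa using hk)
  exact ⟨d.fst, d.snd, d.adj, h1, by simpa using h2⟩

lemma energy_mono (m : ℕ) (H : SimpleGraph (Fin (m + 1))) [DecidableRel H.Adj]
    (hH : H.Connected) (Y : ℕ → ℝ) (hY : ∀ k < m, Y k ≤ Y (k + 1)) :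
    2 * ∑ k ∈ Finset.range m, (Y (k + 1) - Y k) ^ 2 ≤
      ∑ i : Fin (m + 1), ∑ j : Fin (m + 1), if H.Adj i j then (Y i - Y j) ^ 2 else 0 := by
  have h1 : ∀ i j : ℕ, i ≤ j → j ≤ m →
      ∑ k ∈ Finset.Ico i j, (Y (k + 1) - Y k) ^ 2 ≤ (Y j - Y i) ^ 2 := by
    intro i j hij hj
    rw [← Finset.sum_Ico_sub Y hij]
    apply Finset.sum_sq_le_sq_sum_of_nonneg
    intro k hk
    have := hY k (by have := Finset.mem_Ico.1 hk; omega)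
    linarith
  have h2 : ∀ i j : Fin (m + 1), ∑ k ∈ Finset.range m,
      (if (i.val ≤ k ∧ k < j.val) ∨ (j.val ≤ k ∧ k < i.val) then (Y (k + 1) - Y k) ^ 2 else 0)
      ≤ (Y i - Y j) ^ 2 := by
    intro i j
    rw [← Finset.sum_filter]
    rcases le_total i.val j.val with h | h
    · have : (Finset.range m).filter
          (fun k => (i.val ≤ k ∧ k < j.val) ∨ (j.val ≤ k ∧ k < i.val)) = Finset.Ico i.val j.val := by
        ext k; simp only [Finset.mem_filter, Finset.mem_range, Finset.mem_Ico]; omega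
      rw [this]
      have := h1 i j h (by omega)
      nlinarith
    · have : (Finset.range m).filter
          (fun k => (i.val ≤ k ∧ k < j.val) ∨ (j.val ≤ k ∧ k < i.val)) = Finset.Ico j.val i.val := by
        ext k; simp only [Finset.mem_filter, Finset.mem_range, Finset.mem_Ico]; omega
      rw [this]
      exact h1 j i h (by omega)
  let T : ℕ → Fin (m + 1) → Fin (m + 1) → ℝ := fun k i j =>
    if H.Adj i j ∧ ((i.val ≤ k ∧ k < j.val) ∨ (j.val ≤ k ∧ k < i.val))
      then (Y (k + 1) - Y k) ^ 2 else 0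
  have hT0 : ∀ k i j, 0 ≤ T k i j := by
    intro k i j; simp only [T]; split_ifs <;> positivity
  calc 2 * ∑ k ∈ Finset.range m, (Y (k + 1) - Y k) ^ 2
      = ∑ k ∈ Finset.range m, 2 * (Y (k + 1) - Y k) ^ 2 := by rw [Finset.mul_sum]
    _ ≤ ∑ k ∈ Finset.range m, ∑ i, ∑ j, T k i j := by
        apply Finset.sum_le_sum
        intro k hk
        obtain ⟨a, b, hab, ha, hb⟩ := exists_cut_edge m H hH k (Finset.mem_range.1 hk)
        have hne : a ≠ b := hab.ne
        have e1 : T k a b = (Y (k + 1) - Y k) ^ 2 := if_pos ⟨hab, Or.inl ⟨ha, hb⟩⟩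
        have e2 : T k b a = (Y (k + 1) - Y k) ^ 2 := if_pos ⟨hab.symm, Or.inr ⟨ha, hb⟩⟩
        have s1 : T k a b ≤ ∑ j, T k a j :=
          Finset.single_le_sum (f := fun j => T k a j) (fun j _ => hT0 k a j) (Finset.mem_univ b)
        have s2 : T k b a ≤ ∑ j, T k b j :=
          Finset.single_le_sum (f := fun j => T k b j) (fun j _ => hT0 k b j) (Finset.mem_univ a)
        have s3 : ∑ i ∈ {a, b}, ∑ j, T k i j ≤ ∑ i, ∑ j, T k i j :=
          Finset.sum_le_sum_of_subset_of_nonneg (Finset.subset_univ _)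
            (fun i _ _ => Finset.sum_nonneg fun j _ => hT0 k i j)
        rw [Finset.sum_pair hne] at s3
        linarith
    _ = ∑ i, ∑ j, ∑ k ∈ Finset.range m, T k i j := by
        rw [Finset.sum_comm]
        exact Finset.sum_congr rfl fun i _ => Finset.sum_comm
    _ ≤ _ := by
        apply Finset.sum_le_sum; intro i _
        apply Finset.sum_le_sum; intro j _
        by_cases hA : H.Adj i j
        · simp only [T, hA, true_and, if_true]; exact h2 i j
        · simp [T, hA]

lemma energy_lower (n : ℕ) (hn : 2 ≤ n) (G : SimpleGraph (Fin n)) [DecidableRel G.Adj]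
    (hG : G.Connected) (x : Fin n → ℝ) (hx : ∑ i, x i = 0) :
    2 * (1 - Real.cos (Real.pi / n)) * ∑ i, x i ^ 2 ≤
      (∑ i, ∑ j, if G.Adj i j then (x i - x j) ^ 2 else 0) / 2 := by
  classical
  obtain ⟨m, rfl⟩ : ∃ m, n = m + 1 := ⟨n - 1, by omega⟩
  set σ := Tuple.sort x with hσ
  have hmono : Monotone (x ∘ σ) := Tuple.monotone_sort x
  let Y : ℕ → ℝ := fun k => if h : k < m + 1 then x (σ ⟨k, h⟩) else 0
  have hYi : ∀ i : Fin (m + 1), Y i = x (σ i) := by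
    intro i; simp only [Y, i.isLt, dif_pos]
  have hYm : ∀ k < m, Y k ≤ Y (k + 1) := by
    intro k hk
    have := hmono (show (⟨k, by omega⟩ : Fin (m + 1)) ≤ ⟨k + 1, by omega⟩ by simp)
    simp only [Y, show k < m + 1 by omega, show k + 1 < m + 1 by omega, dif_pos]
    exact this
  let H : SimpleGraph (Fin (m + 1)) := G.comap σ
  have hH : H.Connected := (SimpleGraph.Iso.comap σ G).connected_iff.2 hG
  have hE := energy_mono m H hH Y hYm
  have hsum : ∀ f : ℝ → ℝ, ∑ k ∈ Finset.range (m + 1), f (Y k) = ∑ i, f (x i) := by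
    intro f
    rw [Finset.sum_range (fun k => f (Y k))]
    simp only [hYi]
    exact Equiv.sum_comp σ (fun i => f (x i))
  have hW := wirtinger_ineq m (by omega) Y (by rw [← hx]; exact hsum id)
  rw [hsum (fun t => t ^ 2)] at hW
  have hEq : (∑ i : Fin (m + 1), ∑ j : Fin (m + 1), if H.Adj i j then (Y i - Y j) ^ 2 else 0)
      = ∑ i, ∑ j, if G.Adj i j then (x i - x j) ^ 2 else 0 := by
    simp only [hYi, H, SimpleGraph.comap_adj]
    rw [← Equiv.sum_comp σ (fun i => ∑ j, if G.Adj i j then (x i - x j) ^ 2 else 0)]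
    refine Finset.sum_congr rfl fun i _ => ?_
    rw [← Equiv.sum_comp σ (fun j => if G.Adj (σ i) j then (x (σ i) - x j) ^ 2 else 0)]
  rw [hEq] at hE
  linarith

lemma mergeSort_getD (n : ℕ) (hn : 2 ≤ n) (f : Fin n → ℝ) :
    ((List.ofFn f).mergeSort (fun a b => decide (a ≤ b))).getD 1 0
      = f (Tuple.sort f ⟨1, hn⟩) := by
  have h1 : (List.ofFn f).mergeSort (fun a b => decide (a ≤ b)) = List.ofFn (f ∘ Tuple.sort f) := by
    apply List.Perm.eq_of_pairwise' (r := (· ≤ ·))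
    · exact List.pairwise_mergeSort' (· ≤ ·) _
    · exact (Tuple.monotone_sort f).sortedLE_ofFn.pairwise
    · exact (List.mergeSort_perm _ _).trans ((Tuple.sort f).ofFn_comp_perm f).symm
  rw [h1, List.getD_eq_getElem _ _ (by rw [List.length_ofFn]; omega)]
  simp

lemma le_getD (n : ℕ) (hn : 2 ≤ n) (f : Fin n → ℝ) (c : ℝ)
    (h : ∀ i j, i ≠ j → f i < c → f j < c → False) :
    c ≤ ((List.ofFn f).mergeSort (fun a b => decide (a ≤ b))).getD 1 0 := by
  rw [mergeSort_getD n hn]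
  by_contra! hc
  have hm := Tuple.monotone_sort f (show (⟨0, by omega⟩ : Fin n) ≤ ⟨1, hn⟩ by simp)
  simp only [Function.comp] at hm
  refine h (Tuple.sort f ⟨0, by omega⟩) (Tuple.sort f ⟨1, hn⟩) ?_ (by linarith) hc
  intro he
  simpa using (Tuple.sort f).injective he

lemma getD_le (n : ℕ) (hn : 2 ≤ n) (f : Fin n → ℝ) (c : ℝ) (i j : Fin n) (hij : i ≠ j)
    (hi : f i ≤ c) (hj : f j ≤ c) :
    ((List.ofFn f).mergeSort (fun a b => decide (a ≤ b))).getD 1 0 ≤ c := by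
  rw [mergeSort_getD n hn]
  by_contra! hc
  have key : ∀ i, f i ≤ c → ((Tuple.sort f).symm i).val = 0 := by
    intro i hi
    by_contra h0
    have hm := Tuple.monotone_sort f
      (show (⟨1, hn⟩ : Fin n) ≤ (Tuple.sort f).symm i by rw [Fin.le_def]; simp; omega)
    simp only [Function.comp, Equiv.apply_symm_apply] at hm
    linarith
  apply hij
  apply (Tuple.sort f).symm.injective
  apply Fin.ext
  rw [key i hi, key j hj]

lemma connectivity_lower (n : ℕ) (hn : 2 ≤ n) (G : SimpleGraph (Fin n)) (hG : G.Connected) :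
    2 * (1 - Real.cos (Real.pi / n)) ≤ algebraicConnectivity n G := by
  classical
  unfold algebraicConnectivity
  letI : DecidableRel G.Adj := Classical.decRel _
  apply le_getD n hn
  intro i j hij hi hj
  set hA := (SimpleGraph.posSemidef_lapMatrix (R := ℝ) G).1
  set lam := 2 * (1 - Real.cos (Real.pi / n))
  set u : Fin n → ℝ := ⇑(hA.eigenvectorBasis i) with hu
  set v : Fin n → ℝ := ⇑(hA.eigenvectorBasis j) with hv
  have eu : G.lapMatrix ℝ *ᵥ u = hA.eigenvalues i • u := hA.mulVec_eigenvectorBasis i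
  have ev : G.lapMatrix ℝ *ᵥ v = hA.eigenvalues j • v := hA.mulVec_eigenvectorBasis j
  have ho := hA.eigenvectorBasis.orthonormal
  have hin : ∀ a b, (⇑(hA.eigenvectorBasis a) : Fin n → ℝ) ⬝ᵥ ⇑(hA.eigenvectorBasis b)
      = if a = b then 1 else 0 := by
    intro a b
    rw [← orthonormal_iff_ite.1 ho a b]
    simp [PiLp.inner_apply, dotProduct, mul_comm]
  have huu : u ⬝ᵥ u = 1 := by rw [hu, hin]; simp
  have hvv : v ⬝ᵥ v = 1 := by rw [hv, hin]; simp
  have huv : u ⬝ᵥ v = 0 := by rw [hu, hv, hin]; simp [hij]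
  have hvu : v ⬝ᵥ u = 0 := by rw [dotProduct_comm, huv]
  obtain ⟨a, b, hab, hs⟩ : ∃ a b : ℝ, 0 < a ^ 2 + b ^ 2 ∧ a * ∑ k, u k + b * ∑ k, v k = 0 := by
    by_cases h : ∑ k, u k = 0
    · exact ⟨1, 0, by norm_num, by simp [h]⟩
    · exact ⟨- ∑ k, v k, ∑ k, u k, by positivity, by ring⟩
  have hE := energy_lower n hn G hG (a • u + b • v) (by
    simpa [Finset.sum_add_distrib, ← Finset.mul_sum] using hs)
  rw [← SimpleGraph.lapMatrix_toLinearMap₂', Matrix.toLinearMap₂'_apply'] at hE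
  have hsq : ∑ k, (a • u + b • v) k ^ 2 = (a • u + b • v) ⬝ᵥ (a • u + b • v) := by
    simp only [dotProduct, sq]
  rw [hsq, Matrix.mulVec_add, Matrix.mulVec_smul, Matrix.mulVec_smul, eu, ev] at hE
  simp only [dotProduct_add, add_dotProduct, dotProduct_smul, smul_dotProduct, huu, hvv, huv, hvu,
    smul_eq_mul] at hE
  have h3 : 0 ≤ a ^ 2 * (lam - hA.eigenvalues i) := mul_nonneg (sq_nonneg _) (by linarith)
  have h4 : 0 ≤ b ^ 2 * (lam - hA.eigenvalues j) := mul_nonneg (sq_nonneg _) (by linarith)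
  have h5 : a ^ 2 * (lam - hA.eigenvalues i) + b ^ 2 * (lam - hA.eigenvalues j) ≤ 0 := by
    nlinarith
  have h6 : a ^ 2 * (lam - hA.eigenvalues i) = 0 := by linarith
  have h7 : b ^ 2 * (lam - hA.eigenvalues j) = 0 := by linarith
  rcases mul_eq_zero.1 h6 with h8 | h8
  · rcases mul_eq_zero.1 h7 with h9 | h9
    · linarith
    · linarith
  · linarith

lemma exists_eigenvalue {n : ℕ} {A : Matrix (Fin n) (Fin n) ℝ} (hA : A.IsHermitian)
    (v : Fin n → ℝ) (hv : v ≠ 0) (c : ℝ) (h : A *ᵥ v = c • v) : ∃ i, hA.eigenvalues i = c := by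
  have : c ∈ spectrum ℝ A := by
    rw [← Matrix.spectrum_toLin']
    apply Module.End.HasEigenvalue.mem_spectrum
    exact Module.End.hasEigenvalue_of_hasEigenvector
      (Module.End.hasEigenvector_iff.2 ⟨Module.End.mem_eigenspace_iff.2 (by simpa using h), hv⟩)
  rw [hA.spectrum_real_eq_range_eigenvalues] at this
  exact this

lemma path_eigen (n : ℕ) (hn : 2 ≤ n) [DecidableRel (SimpleGraph.pathGraph n).Adj] :
    (SimpleGraph.pathGraph n).lapMatrix ℝ *ᵥ
      (fun k : Fin n => Real.cos ((k.val + 1 / 2) * (Real.pi / n))) =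
    (2 * (1 - Real.cos (Real.pi / n))) •
      (fun k : Fin n => Real.cos ((k.val + 1 / 2) * (Real.pi / n))) := by
  have hn0 : (0 : ℝ) < n := by positivity
  set θ : ℝ := Real.pi / n with hθ
  have hnθ : n * θ = Real.pi := by rw [hθ]; field_simp
  ext i
  rw [SimpleGraph.lapMatrix_mulVec_apply, SimpleGraph.degree_eq_sum_if_adj]
  let c : ℝ → ℝ := fun t => Real.cos ((t + 1 / 2) * θ)
  have hrec : ∀ t : ℝ, c (t + 1) + c (t - 1) = 2 * Real.cos θ * c t := by
    intro t
    have e1 : (t + 1 + 1 / 2) * θ = (t + 1 / 2) * θ + θ := by ring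
    have e2 : (t - 1 + 1 / 2) * θ = (t + 1 / 2) * θ - θ := by ring
    simp only [c]
    rw [e1, e2, Real.cos_add, Real.cos_sub]; ring
  have hL : c (-1) = c 0 := by
    simp only [c]; rw [← Real.cos_neg]; congr 1; ring
  have hR : c (n - 1) = c n := by
    simp only [c]
    rw [show ((n : ℝ) - 1 + 1 / 2) * θ = Real.pi - θ / 2 by linear_combination hnθ,
      show ((n : ℝ) + 1 / 2) * θ = θ / 2 + Real.pi by linear_combination hnθ,
      Real.cos_pi_sub, Real.cos_add_pi]
  have hneigh : ∑ u ∈ (SimpleGraph.pathGraph n).neighborFinset i, c u.val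
      = ∑ u : Fin n, if (SimpleGraph.pathGraph n).Adj i u then c u.val else 0 := by
    rw [← Finset.sum_filter]
    refine Finset.sum_congr ?_ fun _ _ => rfl
    ext u; simp
  change _ * c i.val - ∑ u ∈ (SimpleGraph.pathGraph n).neighborFinset i, c u.val
    = 2 * (1 - Real.cos θ) * c i.val
  rw [hneigh, Finset.sum_mul, ← Finset.sum_sub_distrib]
  have hterm : ∀ u : Fin n, (if (SimpleGraph.pathGraph n).Adj i u then (1 : ℝ) else 0) * c i.val
      - (if (SimpleGraph.pathGraph n).Adj i u then c u.val else 0)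
      = (if u.val = i.val + 1 then c i.val - c (i.val + 1) else 0)
        + (if u.val + 1 = i.val then c i.val - c (i.val - 1) else 0) := by
    intro u
    simp only [SimpleGraph.pathGraph_adj]
    by_cases h1 : u.val = i.val + 1
    · simp [h1]; intro; omega
    · by_cases h2 : u.val + 1 = i.val
      · have : (u.val : ℝ) = (i.val : ℝ) - 1 := by rw [← h2]; push_cast; ring
        simp [h2, h1, this]
      · simp [h2, h1, Ne.symm h1]
  rw [Finset.sum_congr rfl fun u _ => hterm u, Finset.sum_add_distrib]
  have hs1 : ∑ u : Fin n, (if u.val = i.val + 1 then c i.val - c (i.val + 1) else 0)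
      = c i.val - c (i.val + 1) := by
    by_cases h : i.val + 1 < n
    · rw [Finset.sum_eq_single (⟨i.val + 1, h⟩ : Fin n)]
      · simp
      · intro b _ hb; rw [if_neg]; intro h'; exact hb (Fin.ext h')
      · simp
    · have hi : ((i.val : ℕ) : ℝ) = n - 1 := by
        have : i.val + 1 = n := by omega
        have h' : ((i.val : ℕ) : ℝ) + 1 = n := by exact_mod_cast this
        linarith
      rw [hi, hR, Finset.sum_eq_zero]
      · simp
      · intro b _; rw [if_neg]; omega
  have hs2 : ∑ u : Fin n, (if u.val + 1 = i.val then c i.val - c (i.val - 1) else 0)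
      = c i.val - c (i.val - 1) := by
    by_cases h : 0 < i.val
    · rw [Finset.sum_eq_single (⟨i.val - 1, by omega⟩ : Fin n)]
      · rw [if_pos]; simp; omega
      · intro b _ hb; rw [if_neg]; intro h'; apply hb; apply Fin.ext; simp; omega
      · simp
    · have hi : i.val = 0 := by omega
      rw [hi]
      simp [hL]
  rw [hs1, hs2]
  linarith [hrec i.val]

lemma path_upper (n : ℕ) (hn : 2 ≤ n) :
    algebraicConnectivity n (SimpleGraph.pathGraph n) ≤ 2 * (1 - Real.cos (Real.pi / n)) := by
  unfold algebraicConnectivity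
  letI : DecidableRel (SimpleGraph.pathGraph n).Adj := Classical.decRel _
  have hn0 : (0 : ℝ) < n := by positivity
  have hn1 : (2 : ℝ) ≤ n := by exact_mod_cast hn
  have hθ0 : 0 < Real.pi / n := by positivity
  have hθ1 : Real.pi / n ≤ Real.pi / 2 := by gcongr
  have hlt : Real.cos (Real.pi / n) < 1 := by
    rw [← Real.cos_zero]
    exact Real.cos_lt_cos_of_nonneg_of_le_pi_div_two le_rfl hθ1 hθ0
  set hA := (SimpleGraph.posSemidef_lapMatrix (R := ℝ) (SimpleGraph.pathGraph n)).1
  obtain ⟨i, hi⟩ := exists_eigenvalue hA (fun _ => 1)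
    (fun h => by simpa using congrFun h ⟨0, by omega⟩) 0
    (by rw [SimpleGraph.lapMatrix_mulVec_const_eq_zero]; simp)
  obtain ⟨j, hj⟩ := exists_eigenvalue hA _ (fun h => by
      have h0 := congrFun h ⟨0, by omega⟩
      have : 0 < Real.cos ((((0 : ℕ) : ℝ) + 1 / 2) * (Real.pi / n)) :=
        Real.cos_pos_of_mem_Ioo ⟨by push_cast; linarith [Real.pi_pos],
          by push_cast; linarith [Real.pi_pos]⟩
      exact this.ne' h0) _ (path_eigen n hn)
  refine getD_le n hn _ _ i j ?_ (by linarith) hj.le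
  rintro rfl
  linarith

/-- The minimum algebraic connectivity over all connected simple graphs on `n ≥ 2` vertices
equals `2(1 - cos(π/n))`, and it is attained by the path graph on `n` vertices. -/
theorem stmt12 (n : ℕ) (hn : 2 ≤ n) :
    IsLeast {x : ℝ | ∃ G : SimpleGraph (Fin n), G.Connected ∧ algebraicConnectivity n G = x}
      (2 * (1 - Real.cos (Real.pi / n))) ∧
    algebraicConnectivity n (SimpleGraph.pathGraph n) = 2 * (1 - Real.cos (Real.pi / n)) := by
  have hp : algebraicConnectivity n (SimpleGraph.pathGraph n) = 2 * (1 - Real.cos (Real.pi / n)) := by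
    apply le_antisymm (path_upper n hn)
    obtain ⟨m, rfl⟩ : ∃ m, n = m + 1 := ⟨n - 1, by omega⟩
    exact connectivity_lower _ hn _ (SimpleGraph.pathGraph_connected m)
  refine ⟨⟨⟨SimpleGraph.pathGraph n, ?_, hp⟩, ?_⟩, hp⟩
  · obtain ⟨m, rfl⟩ : ∃ m, n = m + 1 := ⟨n - 1, by omega⟩
    exact SimpleGraph.pathGraph_connected m
  · rintro x ⟨G, hG, rfl⟩
    exact connectivity_lower n hn G hG
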